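/- arXiv:2508.18334 — 6 statements merged into one kernel-verified Lean document; each statement's English description precedes it below -/
import Mathlib

section
/- Let u = (p,q) and v = (r,s) be primitive vectors in ℤ² with n := det(u,v) = p·s − q·r ≥ 2. Then there exist a matrix M ∈ SL₂(ℤ) and an integer a with 0 ≤ a < n and gcd(a,n) = 1 such that M·u = (1,0) and M·v = (a,n); moreover for any such M and a one has gcd(p+r, q+s) = gcd(1+a, n) and gcd(p−r, q−s) = gcd(1−a, n). -/
theorem gcd_transform (x y A B c d e f : ℤ) (hdet : c * f - d * e = 1)
    (hA : A = c * x + d * y) (hB : B = e * x + f * y) : Int.gcd x y = Int.gcd A B := by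
  have hx : x = f * A - d * B := by
    rw [hA, hB]; linear_combination (-x) * hdet
  have hy : y = c * B - e * A := by
    rw [hA, hB]; linear_combination (-y) * hdet
  apply Nat.dvd_antisymm
  · apply Int.dvd_gcd
    · rw [hA]
      exact dvd_add (Dvd.dvd.mul_left (Int.gcd_dvd_left x y) _)
        (Dvd.dvd.mul_left (Int.gcd_dvd_right x y) _)
    · rw [hB]
      exact dvd_add (Dvd.dvd.mul_left (Int.gcd_dvd_left x y) _)
        (Dvd.dvd.mul_left (Int.gcd_dvd_right x y) _)
  · have h1 := Int.gcd_dvd_left A B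
    have h2 := Int.gcd_dvd_right A B
    generalize Int.gcd A B = g at *
    apply Int.dvd_gcd
    · rw [hx]
      exact dvd_sub (Dvd.dvd.mul_left h1 _) (Dvd.dvd.mul_left h2 _)
    · rw [hy]
      exact dvd_sub (Dvd.dvd.mul_left h2 _) (Dvd.dvd.mul_left h1 _)

/-- SL₂(ℤ) normal form and thread degrees. Let `u = (p,q)` and `v = (r,s)` be primitive
with `n = det(u,v) = p·s − q·r ≥ 2`. Then there are `M ∈ SL₂(ℤ)` and `0 ≤ a < n` with
`gcd(a,n) = 1`, `M·u = (1,0)` and `M·v = (a,n)`; moreover for any such `M` and `a`,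
`gcd(p+r, q+s) = gcd(1+a, n)` and `gcd(p−r, q−s) = gcd(1−a, n)`. -/
theorem stmt1 (p q r s n : ℤ)
    (hu : Int.gcd p q = 1) (hv : Int.gcd r s = 1)
    (hn : n = p * s - q * r) (h2 : 2 ≤ n) :
    (∃ (M : Matrix.SpecialLinearGroup (Fin 2) ℤ) (a : ℤ),
      0 ≤ a ∧ a < n ∧ Int.gcd a n = 1 ∧
      (M : Matrix (Fin 2) (Fin 2) ℤ).mulVec ![p, q] = ![1, 0] ∧
      (M : Matrix (Fin 2) (Fin 2) ℤ).mulVec ![r, s] = ![a, n]) ∧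
    (∀ (M : Matrix.SpecialLinearGroup (Fin 2) ℤ) (a : ℤ),
      0 ≤ a → a < n → Int.gcd a n = 1 →
      (M : Matrix (Fin 2) (Fin 2) ℤ).mulVec ![p, q] = ![1, 0] →
      (M : Matrix (Fin 2) (Fin 2) ℤ).mulVec ![r, s] = ![a, n] →
      Int.gcd (p + r) (q + s) = Int.gcd (1 + a) n ∧
      Int.gcd (p - r) (q - s) = Int.gcd (1 - a) n) := by
  constructor
  · have hb := Int.gcd_eq_gcd_ab p q
    rw [hu] at hb
    generalize Int.gcdA p q = x at hb
    generalize Int.gcdB p q = y at hb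
    push_cast at hb
    have hk := Int.emod_add_mul_ediv (x * r + y * s) n
    have h0 := Int.emod_nonneg (x * r + y * s) (show n ≠ 0 by omega)
    have h1 := Int.emod_lt_of_pos (x * r + y * s) (show 0 < n by omega)
    generalize (x * r + y * s) / n = k at hk
    generalize (x * r + y * s) % n = a at hk h0 h1
    have hdet : (x + k * q) * p - (y - k * p) * (-q) = 1 := by linear_combination -hb
    have ha : a = (x + k * q) * r + (y - k * p) * s := by
      linear_combination hk - k * hn
    refine ⟨⟨!![x + k * q, y - k * p; -q, p], ?_⟩, a, h0, h1, ?_, ?_, ?_⟩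
    · rw [Matrix.det_fin_two_of]; exact hdet
    · rw [← hv]
      exact (gcd_transform r s a n _ _ (-q) p hdet ha (by rw [hn]; ring)).symm
    · ext i
      fin_cases i
      · simp [Matrix.mulVec, dotProduct, Fin.sum_univ_two]
        linear_combination -hb
      · simp [Matrix.mulVec, dotProduct, Fin.sum_univ_two]
        ring
    · ext i
      fin_cases i
      · simp [Matrix.mulVec, dotProduct, Fin.sum_univ_two]
        linear_combination -ha
      · simp [Matrix.mulVec, dotProduct, Fin.sum_univ_two]
        linear_combination -hn
  · intro M a _ _ _ hMu hMv
    have hdet := M.det_coe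
    rw [Matrix.det_fin_two] at hdet
    have u0 := congrFun hMu 0
    have u1 := congrFun hMu 1
    have v0 := congrFun hMv 0
    have v1 := congrFun hMv 1
    simp only [Matrix.mulVec, dotProduct, Fin.sum_univ_two, Matrix.cons_val_zero,
      Matrix.cons_val_one] at u0 u1 v0 v1
    constructor
    · exact gcd_transform _ _ _ _ _ _ _ _ hdet
        (by linear_combination -u0 - v0) (by linear_combination -u1 - v1)
    · rw [← Int.gcd_neg (a := 1 - a) (b := n)]
      exact gcd_transform _ _ _ _ _ _ _ _ hdet
        (by linear_combination -u0 + v0) (by linear_combination -u1 + v1)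
end

section
/- Let u = (p,q) and v = (r,s) be primitive vectors in ℤ² with n := det(u,v) = p·s − q·r ≥ 2, and set d₊ = gcd(p+r, q+s) and d₋ = gcd(p−r, q−s) (the thread degrees of the two Frohman–Gelca summands). Then the following are equivalent: (i) max{d₊, d₋} = n and min{d₊, d₋} ∈ {1,2}; (ii) u ≡ v (mod n) componentwise or u ≡ −v (mod n) componentwise, i.e. (n ∣ p−r and n ∣ q−s) or (n ∣ p+r and n ∣ q+s). -/
/-- A common divisor of `2p` and `2q`, for `(p,q)` primitive, is `1` or `2`. -/
theorem aux_two (p q r s : ℤ) (hu : Int.gcd p q = 1) (a : ℕ)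
    (h1 : (a : ℤ) ∣ p + r) (h2 : (a : ℤ) ∣ q + s) (h3 : (a : ℤ) ∣ p - r)
    (h4 : (a : ℤ) ∣ q - s) : a = 1 ∨ a = 2 := by
  have hb := Int.gcd_eq_gcd_ab p q
  rw [hu] at hb
  have h5 : (a : ℤ) ∣ 2 := by
    have e : (2 : ℤ) = ((p + r) + (p - r)) * Int.gcdA p q
        + ((q + s) + (q - s)) * Int.gcdB p q := by
      push_cast at hb
      linear_combination 2 * hb
    rw [e]
    exact dvd_add (Dvd.dvd.mul_right (dvd_add h1 h3) _) (Dvd.dvd.mul_right (dvd_add h2 h4) _)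
  have h6 : a ∣ 2 := by exact_mod_cast h5
  exact (Nat.dvd_prime Nat.prime_two).1 h6

/-- Characterization of the small co-thread regime. Let `u = (p,q)`, `v = (r,s)` be primitive
with `n = det(u,v) ≥ 2`, and let `d₊ = gcd(p+r, q+s)`, `d₋ = gcd(p−r, q−s)` be the thread
degrees. Then `max{d₊,d₋} = n` and `min{d₊,d₋} ∈ {1,2}` iff `u ≡ ±v (mod n)` componentwise. -/
theorem stmt3 (p q r s n : ℤ)
    (hu : Int.gcd p q = 1) (hv : Int.gcd r s = 1)
    (hn : n = p * s - q * r) (h2 : 2 ≤ n) :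
    ((max (Int.gcd (p + r) (q + s)) (Int.gcd (p - r) (q - s)) : ℤ) = n ∧
      (min (Int.gcd (p + r) (q + s)) (Int.gcd (p - r) (q - s)) = 1 ∨
        min (Int.gcd (p + r) (q + s)) (Int.gcd (p - r) (q - s)) = 2))
    ↔ ((n ∣ p - r ∧ n ∣ q - s) ∨ (n ∣ p + r ∧ n ∣ q + s)) := by
  have a1 := Int.gcd_dvd_left (p + r) (q + s)
  have a2 := Int.gcd_dvd_right (p + r) (q + s)
  have b1 := Int.gcd_dvd_left (p - r) (q - s)
  have b2 := Int.gcd_dvd_right (p - r) (q - s)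
  have ha : n ∣ p + r → n ∣ q + s → n ∣ (Int.gcd (p + r) (q + s) : ℤ) := Int.dvd_coe_gcd
  have hb : n ∣ p - r → n ∣ q - s → n ∣ (Int.gcd (p - r) (q - s) : ℤ) := Int.dvd_coe_gcd
  generalize Int.gcd (p + r) (q + s) = a at *
  generalize Int.gcd (p - r) (q - s) = b at *
  have an : (a : ℤ) ∣ n := by
    have e : n = p * (q + s) - q * (p + r) := by rw [hn]; ring
    rw [e]
    exact dvd_sub (Dvd.dvd.mul_left a2 _) (Dvd.dvd.mul_left a1 _)
  have bn : (b : ℤ) ∣ n := by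
    have e : n = q * (p - r) - p * (q - s) := by rw [hn]; ring
    rw [e]
    exact dvd_sub (Dvd.dvd.mul_left b1 _) (Dvd.dvd.mul_left b2 _)
  constructor
  · rintro ⟨h, -⟩
    rcases max_choice (a : ℤ) (b : ℤ) with h' | h'
    · rw [h'] at h
      subst h
      exact Or.inr ⟨a1, a2⟩
    · rw [h'] at h
      rw [h] at b1 b2
      exact Or.inl ⟨b1, b2⟩
  · rintro (⟨h, h'⟩ | ⟨h, h'⟩)
    · have e : (b : ℤ) = n := Int.dvd_antisymm (by positivity) (by linarith) bn (hb h h')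
      have := aux_two p q r s hu a a1 a2 (an.trans h) (an.trans h')
      omega
    · have e : (a : ℤ) = n := Int.dvd_antisymm (by positivity) (by linarith) an (ha h h')
      have := aux_two p q r s hu b (bn.trans h) (bn.trans h') b1 b2
      omega
end

section
/- Let u = (p,q) and v = (r,s) be primitive vectors in ℤ² with n := det(u,v) = p·s − q·r ≥ 2, and suppose u ≡ v (mod n) componentwise, i.e. n ∣ p−r and n ∣ q−s. Then gcd(p−r, q−s) = n and gcd(p+r, q+s) = gcd(2,n); in particular the non-maximal thread degree equals 1 if n is odd and 2 if n is even. -/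
/-- Maximal-thread degrees in the congruent case. Let `u = (p,q)`, `v = (r,s)` be primitive
with `n = det(u,v) ≥ 2` and `u ≡ v (mod n)` componentwise. Then `gcd(p−r, q−s) = n` and
`gcd(p+r, q+s) = gcd(2,n)`; in particular the latter is `1` if `n` is odd and `2` if `n`
is even. -/
theorem stmt4 (p q r s n : ℤ)
    (hu : Int.gcd p q = 1) (hv : Int.gcd r s = 1)
    (hn : n = p * s - q * r) (h2 : 2 ≤ n)
    (hp : n ∣ p - r) (hq : n ∣ q - s) :
    (Int.gcd (p - r) (q - s) : ℤ) = n ∧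
    Int.gcd (p + r) (q + s) = Int.gcd 2 n ∧
    (Odd n → Int.gcd (p + r) (q + s) = 1) ∧
    (Even n → Int.gcd (p + r) (q + s) = 2) := by
  obtain ⟨a, ha⟩ := hp
  obtain ⟨b, hb⟩ := hq
  have hr : r = p - n * a := by linarith
  have hs : s = q - n * b := by linarith
  have hab : q * a - p * b = 1 := by
    have h : n * (q * a - p * b) = n * 1 := by
      rw [hr, hs] at hn
      linarith
    exact mul_left_cancel₀ (by omega) h
  have hco : Int.gcd a b = 1 := by
    rw [← Int.isCoprime_iff_gcd_eq_one]
    exact ⟨q, -p, by linarith⟩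
  have key : Int.gcd (p + r) (q + s) = Int.gcd 2 n := by
    apply Nat.dvd_antisymm
    · have h1 : (Int.gcd (p + r) (q + s) : ℤ) ∣ p + r := Int.gcd_dvd_left ..
      have h2 : (Int.gcd (p + r) (q + s) : ℤ) ∣ q + s := Int.gcd_dvd_right ..
      apply Int.dvd_gcd
      · have e : (2 : ℤ) = (q + s) * a - (p + r) * b := by
          rw [hr, hs]
          linear_combination (-2) * hab
        rw [e]
        exact dvd_sub (h2.mul_right _) (h1.mul_right _)
      · have e : n = (q + s) * p - (p + r) * q := by
          rw [hn]
          ring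
        have := dvd_sub (h2.mul_right p) (h1.mul_right q)
        rwa [← e] at this
    · have h1 : (Int.gcd 2 n : ℤ) ∣ 2 := Int.gcd_dvd_left ..
      have h2 : (Int.gcd 2 n : ℤ) ∣ n := Int.gcd_dvd_right ..
      apply Int.dvd_gcd
      · have e : p + r = 2 * p - n * a := by linarith
        rw [e]
        exact dvd_sub (h1.mul_right _) (h2.mul_right _)
      · have e : q + s = 2 * q - n * b := by linarith
        rw [e]
        exact dvd_sub (h1.mul_right _) (h2.mul_right _)
  refine ⟨?_, key, ?_, ?_⟩
  · rw [ha, hb, Int.gcd_mul_left, hco]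
    omega
  · rintro ⟨k, hk⟩
    rw [key, ← Int.isCoprime_iff_gcd_eq_one]
    exact ⟨-k, 1, by linarith⟩
  · intro h
    rw [key, Int.gcd_eq_left_iff_dvd (by norm_num) |>.mpr h.two_dvd |> fun h => (by exact_mod_cast h : Int.gcd 2 n = 2)]
end

section
/- Let u = (p,q) and v = (r,s) be primitive vectors in ℤ² with n := det(u,v) = p·s − q·r ≥ 2, and suppose n ∣ p−r and n ∣ q−s. Then there exists M ∈ SL₂(ℤ) with M·u = (1,0) and M·v = (1,n); that is, every such pair is SL₂(ℤ)-equivalent to the standard pair ((1,0),(1,n)). -/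
/-- Every primitive pair `u = (p,q)`, `v = (r,s)` with `n = det(u,v) ≥ 2` and
`u ≡ v (mod n)` componentwise is SL₂(ℤ)-equivalent to the standard pair `((1,0),(1,n))`. -/
theorem stmt6 (p q r s n : ℤ)
    (hu : Int.gcd p q = 1) (hv : Int.gcd r s = 1)
    (hn : n = p * s - q * r) (h2 : 2 ≤ n)
    (hp : n ∣ p - r) (hq : n ∣ q - s) :
    ∃ M : Matrix.SpecialLinearGroup (Fin 2) ℤ,
      (M : Matrix (Fin 2) (Fin 2) ℤ).mulVec ![p, q] = ![1, 0] ∧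
      (M : Matrix (Fin 2) (Fin 2) ℤ).mulVec ![r, s] = ![1, n] := by
  obtain ⟨a, ha⟩ := hp
  obtain ⟨b, hb⟩ := hq
  have h1 : q * a - p * b = 1 := by
    have hn0 : n ≠ 0 := by omega
    apply mul_left_cancel₀ hn0
    linear_combination (-q) * ha + p * hb - hn
  refine ⟨⟨!![-b, a; -q, p], ?_⟩, ?_, ?_⟩
  · rw [Matrix.det_fin_two_of]
    linear_combination h1
  · ext i
    fin_cases i
    · simp [Matrix.mulVec, dotProduct, Fin.sum_univ_two]
      linear_combination h1
    · simp [Matrix.mulVec, dotProduct, Fin.sum_univ_two]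
      ring
  · ext i
    fin_cases i
    · simp [Matrix.mulVec, dotProduct, Fin.sum_univ_two]
      linear_combination h1 + b * ha - a * hb
    · simp [Matrix.mulVec, dotProduct, Fin.sum_univ_two]
      linear_combination -hn
end

section
/- (Chebyshev cascade identity, odd case.) Let R be a commutative ring, t a unit of R, and μ ∈ R. For every odd integer n ≥ 3 one has μ·G_n = t·G_{n−1} + t^{−1}·G_{n+1} − t^{−n}. -/
open Polynomial Finset

/-- The Chebyshev cascade `G_n`: for `n ≥ 2`,
`G n = ∑_{j=0}^{⌊(n−2)/2⌋} t^{n−2−2j}·(T_{n−2−2j}(μ) − δ_{n−2−2j,0})·S_j(t² + t⁻²)`,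
with `G 0 = G 1 = 0`. Here `T` (resp. `S`) is the normalized Chebyshev polynomial of the
first (resp. second) kind, i.e. the Dickson polynomial of the first (resp. second) kind
with parameter `1`. -/
noncomputable def cascadeG {R : Type*} [CommRing R] (t : Rˣ) (μ : R) (n : ℕ) : R :=
  if n < 2 then 0 else
    ∑ j ∈ Finset.range ((n - 2) / 2 + 1),
      (t : R) ^ (n - 2 - 2 * j) *
        ((Polynomial.dickson 1 (1 : R) (n - 2 - 2 * j)).eval μ -
          if n - 2 - 2 * j = 0 then 1 else 0) *
        (Polynomial.dickson 2 (1 : R) j).eval ((t : R) ^ 2 + ((t⁻¹ : Rˣ) : R) ^ 2)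

lemma conv_rec {R : Type*} [CommRing R] (c : R) (g s : ℕ → R) (h0 : s 0 = 1) (h1 : s 1 = c)
    (hs : ∀ j, s (j + 2) = c * s (j + 1) - s j) (m : ℕ) :
    ∑ j ∈ Finset.range (m + 3), g (m + 2 - j) * s j =
      g (m + 2) + c * ∑ j ∈ Finset.range (m + 2), g (m + 1 - j) * s j
        - ∑ j ∈ Finset.range (m + 1), g (m - j) * s j := by
  rw [Finset.sum_range_succ', Finset.sum_range_succ', Finset.sum_range_succ' _ (m + 1)]
  have e : ∀ j, m + 2 - (j + 1 + 1) = m - j := fun j => by omega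
  have e' : ∀ j, m + 1 - (j + 1) = m - j := fun j => by omega
  have e2 : m + 2 - (0 + 1) = m + 1 := by omega
  simp only [e, e', e2, Nat.sub_zero, zero_add, h0, h1]
  have : ∑ j ∈ Finset.range (m + 1), g (m - j) * s (j + 1 + 1) =
      c * ∑ j ∈ Finset.range (m + 1), g (m - j) * s (j + 1)
        - ∑ j ∈ Finset.range (m + 1), g (m - j) * s j := by
    rw [Finset.mul_sum, ← Finset.sum_sub_distrib]
    refine Finset.sum_congr rfl fun j _ => ?_
    rw [show j + 1 + 1 = j + 2 from rfl, hs]; ring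
  rw [this]; ring

/-- The first factor of the summands of the cascade. -/
noncomputable def cascF {R : Type*} [CommRing R] (t : Rˣ) (μ : R) (k : ℕ) : R :=
  (t : R) ^ k * ((Polynomial.dickson 1 (1 : R) k).eval μ - if k = 0 then 1 else 0)

lemma cascadeG_eq {R : Type*} [CommRing R] (t : Rˣ) (μ : R) (m e : ℕ) (he : e < 2) :
    cascadeG t μ (2 * m + e + 2) = ∑ j ∈ Finset.range (m + 1), cascF t μ (2 * (m - j) + e) *
      (Polynomial.dickson 2 (1 : R) j).eval ((t : R) ^ 2 + ((t⁻¹ : Rˣ) : R) ^ 2) := by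
  rw [cascadeG, if_neg (by omega)]
  rw [show (2 * m + e + 2 - 2) / 2 + 1 = m + 1 by omega]
  refine Finset.sum_congr rfl fun j hj => ?_
  rw [Finset.mem_range] at hj
  rw [show 2 * m + e + 2 - 2 - 2 * j = 2 * (m - j) + e by omega, cascF]

lemma cascadeG_rec {R : Type*} [CommRing R] (t : Rˣ) (μ : R) (m e : ℕ) (he : e < 2) :
    cascadeG t μ (2 * (m + 2) + e + 2) = cascF t μ (2 * (m + 2) + e) +
      ((t : R) ^ 2 + ((t⁻¹ : Rˣ) : R) ^ 2) * cascadeG t μ (2 * (m + 1) + e + 2)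
      - cascadeG t μ (2 * m + e + 2) := by
  rw [cascadeG_eq _ _ _ _ he, cascadeG_eq _ _ _ _ he, cascadeG_eq _ _ _ _ he]
  refine conv_rec _ (fun k => cascF t μ (2 * k + e)) _ ?_ ?_ ?_ m
  · simp [Polynomial.dickson_zero]; norm_num
  · simp
  · intro j
    simp [Polynomial.dickson_add_two]

lemma cascade_aux {R : Type*} [CommRing R] (t : Rˣ) (μ : R) (m : ℕ) :
    μ * cascadeG t μ (2 * m + 3) =
      (t : R) * cascadeG t μ (2 * m + 2) + ((t⁻¹ : Rˣ) : R) * cascadeG t μ (2 * m + 4) -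
        ((t⁻¹ : Rˣ) : R) ^ (2 * m + 3) := by
  have hu : (t : R) * ((t⁻¹ : Rˣ) : R) = 1 := t.mul_inv
  induction m using Nat.twoStepInduction with
  | zero =>
    have a := cascadeG_eq t μ 0 0 (by norm_num)
    have b := cascadeG_eq t μ 0 1 (by norm_num)
    have c := cascadeG_eq t μ 1 0 (by norm_num)
    simp [Finset.sum_range_succ, cascF, Polynomial.dickson_two] at a b c ⊢
    rw [a, b, c]
    generalize ((t⁻¹ : Rˣ) : R) = u at *
    generalize (t : R) = t at *
    grind
  | one =>
    have a := cascadeG_eq t μ 1 0 (by norm_num)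
    have b := cascadeG_eq t μ 1 1 (by norm_num)
    have c := cascadeG_eq t μ 2 0 (by norm_num)
    have d4 : (Polynomial.dickson 1 (1 : R) 4).eval μ = μ ^ 4 - 4 * μ ^ 2 + 2 := by
      simp [Polynomial.dickson_add_two _ _ 2, Polynomial.dickson_add_two _ _ 1,
        Polynomial.dickson_two]; ring
    have d3 : (Polynomial.dickson 1 (1 : R) 3).eval μ = μ ^ 3 - 3 * μ := by
      simp [Polynomial.dickson_add_two _ _ 1, Polynomial.dickson_two]; ring
    simp [Finset.sum_range_succ, cascF, Polynomial.dickson_two, d3, d4] at a b c ⊢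
    rw [a, b, c]
    generalize ((t⁻¹ : Rˣ) : R) = u at *
    generalize (t : R) = t at *
    grind
  | more m ih1 ih2 =>
    have a := cascadeG_rec t μ m 0 (by norm_num)
    have b := cascadeG_rec t μ m 1 (by norm_num)
    have c := cascadeG_rec t μ (m + 1) 0 (by norm_num)
    have d : (Polynomial.dickson 1 (1 : R) (2 * m + 6)).eval μ =
        μ * (Polynomial.dickson 1 (1 : R) (2 * m + 5)).eval μ
          - (Polynomial.dickson 1 (1 : R) (2 * m + 4)).eval μ := by
      simp [Polynomial.dickson_add_two _ _ (2 * m + 4)]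
    have f4 : cascF t μ (2 * m + 4) = (t : R) ^ (2 * m + 4) *
      (Polynomial.dickson 1 (1 : R) (2 * m + 4)).eval μ := by simp [cascF]
    have f5 : cascF t μ (2 * m + 5) = (t : R) ^ (2 * m + 4) * t *
      (Polynomial.dickson 1 (1 : R) (2 * m + 5)).eval μ := by simp [cascF, pow_succ]
    have f6 : cascF t μ (2 * m + 6) = (t : R) ^ (2 * m + 4) * t ^ 2 *
      (Polynomial.dickson 1 (1 : R) (2 * m + 6)).eval μ := by
        simp [cascF]; ring
    have hF : μ * cascF t μ (2 * m + 5) =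
        t * cascF t μ (2 * m + 4) + ((t⁻¹ : Rˣ) : R) * cascF t μ (2 * m + 6) := by
      rw [f4, f5, f6, d]
      generalize ((t⁻¹ : Rˣ) : R) = u at *
      generalize (t : R) ^ (2 * m + 4) = p
      generalize (Polynomial.dickson 1 (1 : R) (2 * m + 4)).eval μ = x
      generalize (Polynomial.dickson 1 (1 : R) (2 * m + 5)).eval μ = y
      linear_combination (-p * t * (μ * y - x)) * hu
    simp only [mul_add, add_assoc, Nat.reduceMul, Nat.reduceAdd, mul_one] at a b c ih1 ih2 ⊢
    simp only [pow_add _ (2 * m)] at ih1 ih2 ⊢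
    generalize ((t⁻¹ : Rˣ) : R) ^ (2 * m) = q at *
    generalize ((t⁻¹ : Rˣ) : R) = u at *
    rw [a, b, c]
    linear_combination hF + (t ^ 2 + u ^ 2) * ih2 - ih1 - q * u ^ 3 * (t * u + 1) * hu

/-- Chebyshev cascade identity, odd case: for odd `n ≥ 3`,
`μ·G_n = t·G_{n−1} + t⁻¹·G_{n+1} − t^{−n}`. -/
theorem stmt7 {R : Type*} [CommRing R] (t : Rˣ) (μ : R) (n : ℕ)
    (h3 : 3 ≤ n) (hodd : Odd n) :
    μ * cascadeG t μ n =
      (t : R) * cascadeG t μ (n - 1) + ((t⁻¹ : Rˣ) : R) * cascadeG t μ (n + 1) -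
        ((t ^ (-(n : ℤ)) : Rˣ) : R) := by
  obtain ⟨k, rfl⟩ := hodd
  obtain ⟨m, rfl⟩ : ∃ m, k = m + 1 := ⟨k - 1, by omega⟩
  have h := cascade_aux t μ m
  have e : ((t ^ (-((2 * (m + 1) + 1 : ℕ) : ℤ)) : Rˣ) : R) = ((t⁻¹ : Rˣ) : R) ^ (2 * m + 3) := by
    rw [zpow_neg, zpow_natCast, ← inv_pow, Units.val_pow_eq_pow_val]
    rfl
  rw [e]
  exact h
end

section
/- (Chebyshev cascade identity, even case.) Let R be a commutative ring, t a unit of R, and μ ∈ R. For every even integer n ≥ 2 one has μ·G_n = t·G_{n−1} + t^{−1}·G_{n+1}. -/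
open Polynomial Finset

/-- Chebyshev cascade identity, even case: for even `n ≥ 2`,
`μ·G_n = t·G_{n−1} + t⁻¹·G_{n+1}`. -/
theorem stmt8 {R : Type*} [CommRing R] (t : Rˣ) (μ : R) (n : ℕ)
    (h2 : 2 ≤ n) (heven : Even n) :
    μ * cascadeG t μ n =
      (t : R) * cascadeG t μ (n - 1) + ((t⁻¹ : Rˣ) : R) * cascadeG t μ (n + 1) := by
  obtain ⟨m, rfl⟩ : ∃ m, n = 2 * m + 2 := by
    obtain ⟨k, hk⟩ := heven
    exact ⟨k - 1, by omega⟩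
  have e1 : cascadeG t μ (2 * m + 2) =
      (∑ j ∈ Finset.range m, (t : R) ^ (2 * (m - j)) *
        (Polynomial.dickson 1 (1 : R) (2 * (m - j))).eval μ *
        (Polynomial.dickson 2 (1 : R) j).eval ((t : R) ^ 2 + ((t⁻¹ : Rˣ) : R) ^ 2)) +
      (Polynomial.dickson 2 (1 : R) m).eval ((t : R) ^ 2 + ((t⁻¹ : Rˣ) : R) ^ 2) := by
    unfold cascadeG
    rw [if_neg (by omega), show (2 * m + 2 - 2) / 2 + 1 = m + 1 by omega,
      Finset.sum_range_succ]
    congr 1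
    · refine Finset.sum_congr rfl fun j hj => ?_
      have hj' := Finset.mem_range.mp hj
      rw [show 2 * m + 2 - 2 - 2 * j = 2 * (m - j) by omega, if_neg (by omega), sub_zero]
    · rw [show 2 * m + 2 - 2 - 2 * m = 0 by omega, if_pos rfl]
      simp only [Polynomial.dickson_zero]
      norm_num
  have e2 : cascadeG t μ (2 * m + 2 - 1) =
      ∑ j ∈ Finset.range m, (t : R) ^ (2 * (m - j) - 1) *
        (Polynomial.dickson 1 (1 : R) (2 * (m - j) - 1)).eval μ *
        (Polynomial.dickson 2 (1 : R) j).eval ((t : R) ^ 2 + ((t⁻¹ : Rˣ) : R) ^ 2) := by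
    unfold cascadeG
    rcases Nat.eq_zero_or_pos m with rfl | hm
    · simp
    rw [if_neg (by omega), show (2 * m + 2 - 1 - 2) / 2 + 1 = m by omega]
    refine Finset.sum_congr rfl fun j hj => ?_
    have hj' := Finset.mem_range.mp hj
    rw [show 2 * m + 2 - 1 - 2 - 2 * j = 2 * (m - j) - 1 by omega, if_neg (by omega), sub_zero]
  have e3 : cascadeG t μ (2 * m + 2 + 1) =
      (∑ j ∈ Finset.range m, (t : R) ^ (2 * (m - j) + 1) *
        (Polynomial.dickson 1 (1 : R) (2 * (m - j) + 1)).eval μ *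
        (Polynomial.dickson 2 (1 : R) j).eval ((t : R) ^ 2 + ((t⁻¹ : Rˣ) : R) ^ 2)) +
      (t : R) * μ *
      (Polynomial.dickson 2 (1 : R) m).eval ((t : R) ^ 2 + ((t⁻¹ : Rˣ) : R) ^ 2) := by
    unfold cascadeG
    rw [if_neg (by omega), show (2 * m + 2 + 1 - 2) / 2 + 1 = m + 1 by omega,
      Finset.sum_range_succ]
    congr 1
    · refine Finset.sum_congr rfl fun j hj => ?_
      have hj' := Finset.mem_range.mp hj
      rw [show 2 * m + 2 + 1 - 2 - 2 * j = 2 * (m - j) + 1 by omega, if_neg (by omega), sub_zero]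
    · rw [show 2 * m + 2 + 1 - 2 - 2 * m = 1 by omega, if_neg (by omega)]
      simp
  have hu : ((t⁻¹ : Rˣ) : R) * (t : R) = 1 := t.inv_mul
  rw [e1, e2, e3, mul_add, mul_add, ← mul_assoc _ ((t : R) * μ), ← mul_assoc _ (t : R) μ, hu,
    one_mul, ← add_assoc]
  congr 1
  rw [Finset.mul_sum, Finset.mul_sum, Finset.mul_sum, ← Finset.sum_add_distrib]
  refine Finset.sum_congr rfl fun j hj => ?_
  have hj' := Finset.mem_range.mp hj
  obtain ⟨k, hk⟩ : ∃ k, 2 * (m - j) = k + 1 := ⟨2 * (m - j) - 1, by omega⟩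
  rw [hk, Nat.add_sub_cancel, show k + 1 + 1 = k + 2 from rfl, Polynomial.dickson_add_two]
  generalize (Polynomial.dickson 2 (1 : R) j).eval ((t : R) ^ 2 + ((t⁻¹ : Rˣ) : R) ^ 2) = s
  simp only [Polynomial.eval_sub, Polynomial.eval_mul, Polynomial.eval_X, Polynomial.eval_C,
    one_mul]
  generalize (Polynomial.dickson 1 (1 : R) (k + 1)).eval μ = a
  generalize (Polynomial.dickson 1 (1 : R) k).eval μ = b
  linear_combination (-(t : R) ^ (k + 1) * (μ * a - b) * s) * hu
end
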